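/- For every n ≥ 1 and all indices 0 < i < j < 2^n: c^{n+1}_{x_i,x_j} = (5/3)·c^n_{x_i,x_j} + 196·25^{n+1}·(10·3^{n+1} + 39·10^{n+1}) / ((3^{n+1} + 6·10^{n+1})·(5·3^{n+1} + 16·10^{n+1})·(5·3^{n+1} + 9·10^{n+1})), where on the left-hand side x_i, x_j denote the level-(n+1) bottom-row points q₁ + (i/2^{n+1})(q₂ − q₁), q₁ + (j/2^{n+1})(q₂ − q₁), and on the right-hand side the level-n bottom-row points q₁ + (i/2^n)(q₂ − q₁), q₁ + (j/2^n)(q₂ − q₁). -/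

import Mathlib

open scoped BigOperators

noncomputable section

namespace SGPaper

/-- The three corners of the Sierpinski gasket:
`q₀ = (1/2, √3/2)`, `q₁ = (0,0)`, `q₂ = (1,0)`. -/
def q : Fin 3 → ℝ × ℝ
  | 0 => (1 / 2, Real.sqrt 3 / 2)
  | 1 => (0, 0)
  | 2 => (1, 0)

/-- The contraction map towards corner `i`: `F_i(x) = (x + q_i)/2`. -/
def Fmap (i : Fin 3) (x : ℝ × ℝ) : ℝ × ℝ := (2⁻¹ : ℝ) • (x + q i)

/-- `Fword w = F_{w₁} ∘ ⋯ ∘ F_{w_m}` for the word `w = w₁⋯w_m`. -/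
def Fword (w : List (Fin 3)) : ℝ × ℝ → ℝ × ℝ :=
  w.foldr (fun i f => Fmap i ∘ f) id

/-- The level-`m` vertex set of the Sierpinski gasket:
`V_m = ⋃_{|w| = m} F_w({q₀, q₁, q₂})`. -/
def V (m : ℕ) : Set (ℝ × ℝ) :=
  {x | ∃ w : List (Fin 3), w.length = m ∧ ∃ i : Fin 3, x = Fword w (q i)}

/-- `x` and `y` are `m`-neighbors: they are distinct and belong to a common
level-`m` cell `F_w({q₀, q₁, q₂})`. -/
def Nbr (m : ℕ) (x y : ℝ × ℝ) : Prop :=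
  x ≠ y ∧ ∃ w : List (Fin 3), w.length = m ∧
    (∃ i : Fin 3, x = Fword w (q i)) ∧ (∃ j : Fin 3, y = Fword w (q j))

/-- The value `(u x - u y)²` on the unordered pair `{x, y}`. -/
def edgeVal (u : ℝ × ℝ → ℝ) : Sym2 (ℝ × ℝ) → ℝ :=
  Sym2.lift ⟨fun x y => (u x - u y) ^ 2, fun _ _ => by ring⟩

/-- The unordered pair `e` is an edge of the level-`m` graph `Γ_m`. -/
def IsEdge (m : ℕ) (e : Sym2 (ℝ × ℝ)) : Prop :=
  ∃ x y : ℝ × ℝ, Nbr m x y ∧ e = s(x, y)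

/-- The level-`m` graph energy: `E_m(u) = (5/3)^m Σ (u x − u y)²`, the sum being over
unordered `m`-neighbor pairs `{x, y}` (a finite set, so `tsum` is the honest sum). -/
def Energy (m : ℕ) (u : ℝ × ℝ → ℝ) : ℝ :=
  (5 / 3 : ℝ) ^ m * ∑' e : {e : Sym2 (ℝ × ℝ) // IsEdge m e}, edgeVal u e

/-- `Q_E(v)`: minimal level-`m` energy among functions `u : V_m → ℝ` agreeing
with `v` on `E` (the minimum is attained, so it equals this infimum). -/
def Q (m : ℕ) (E : Set (ℝ × ℝ)) (v : ℝ × ℝ → ℝ) : ℝ :=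
  sInf {r | ∃ u : ℝ × ℝ → ℝ, (∀ x ∈ E, u x = v x) ∧ r = Energy m u}

/-- Indicator function of the point `z`. -/
def ind (z : ℝ × ℝ) : ℝ × ℝ → ℝ := fun t => if t = z then 1 else 0

/-- The conductance `c^E_{x,y} = (Q_E(𝟙_x) + Q_E(𝟙_y) − Q_E(𝟙_x + 𝟙_y))/2`
between `x, y ∈ E`, computed at level `m`. -/
def cond (m : ℕ) (E : Set (ℝ × ℝ)) (x y : ℝ × ℝ) : ℝ :=
  (Q m E (ind x) + Q m E (ind y) - Q m E (ind x + ind y)) / 2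

/-- The `j`-th bottom-row point of `V_n`: `x_j = q₁ + (j/2ⁿ)(q₂ − q₁)`. -/
def xb (n j : ℕ) : ℝ × ℝ := q 1 + ((j : ℝ) / 2 ^ n) • (q 2 - q 1)

/-- The bottom row `Ẽ_n = {x₀, …, x_{2ⁿ}}` of `V_n`. -/
def Ebot (n : ℕ) : Set (ℝ × ℝ) := {p | ∃ j ≤ 2 ^ n, p = xb n j}

/-- The bottom row together with the top point: `E_n⁺ = {q₀, x₀, …, x_{2ⁿ}}`. -/
def Eplus (n : ℕ) : Set (ℝ × ℝ) := insert (q 0) (Ebot n)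

section Helpers

def bary : Fin 3 → ℝ × ℝ → ℝ
  | 0 => fun p => 2 * p.2 / Real.sqrt 3
  | 1 => fun p => 1 - p.1 - p.2 / Real.sqrt 3
  | 2 => fun p => p.1 - p.2 / Real.sqrt 3

def Tri : Set (ℝ × ℝ) := {p | ∀ k, 0 ≤ bary k p}

lemma sqrt3_pos : 0 < Real.sqrt 3 := by positivity

lemma bary_sum (p : ℝ × ℝ) : bary 0 p + bary 1 p + bary 2 p = 1 := by
  simp only [bary]; ring

lemma bary_F (i k : Fin 3) (p : ℝ × ℝ) :
    bary k (Fmap i p) = (bary k p + if k = i then 1 else 0) / 2 := by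
  have := sqrt3_pos.ne'
  fin_cases i <;> fin_cases k <;> simp [bary, Fmap, q] <;> field_simp <;> ring

lemma bary_q (i k : Fin 3) : bary k (q i) = if k = i then 1 else 0 := by
  have := sqrt3_pos.ne'
  fin_cases i <;> fin_cases k <;> simp [bary, q] <;> field_simp <;> ring

lemma bary_inj {p r : ℝ × ℝ} (h : ∀ k, bary k p = bary k r) : p = r := by
  have h0 := h 0
  have h2 := h 2
  simp only [bary] at h0 h2
  have := sqrt3_pos.ne'
  have hy : p.2 = r.2 := by field_simp at h0; linarith
  rw [hy] at h2
  exact Prod.ext (by linarith) hy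

lemma q_inj {i j : Fin 3} (h : q i = q j) : i = j := by
  by_contra hne
  have h1 := bary_q i i
  rw [h, bary_q, if_neg hne] at h1
  simp at h1

lemma F_inj (i : Fin 3) : Function.Injective (Fmap i) := by
  intro p r h
  apply bary_inj
  intro k
  have h1 := bary_F i k p
  rw [h, bary_F] at h1
  linarith

lemma q_mem (i : Fin 3) : q i ∈ Tri := by
  intro k; rw [bary_q]; split_ifs <;> norm_num

lemma F_mem (i : Fin 3) {p : ℝ × ℝ} (hp : p ∈ Tri) : Fmap i p ∈ Tri := by
  intro k; rw [bary_F]; have := hp k; split_ifs <;> linarith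

/-- Two cells meet at a single point. -/
lemma cell_inter {i j : Fin 3} (hij : i ≠ j) {p r : ℝ × ℝ} (hp : p ∈ Tri) (hr : r ∈ Tri)
    (h : Fmap i p = Fmap j r) : p = q j ∧ r = q i := by
  have e := fun k => (bary_F i k p).symm.trans ((congrArg (bary k) h).trans (bary_F j k r))
  have e0 := e 0
  have e1 := e 1
  have e2 := e 2
  have p0 := hp 0
  have p1 := hp 1
  have p2 := hp 2
  have r0 := hr 0
  have r1 := hr 1
  have r2 := hr 2
  have sp := bary_sum p
  have sr := bary_sum r
  constructor <;> apply bary_inj <;> intro k <;> rw [bary_q] <;>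
  fin_cases i <;> fin_cases j <;> fin_cases k <;>
    simp at hij e0 e1 e2 ⊢ <;> linarith

lemma Fword_cons (i : Fin 3) (w : List (Fin 3)) (p : ℝ × ℝ) :
    Fword (i :: w) p = Fmap i (Fword w p) := rfl

lemma Fword_mem (w : List (Fin 3)) {p : ℝ × ℝ} (hp : p ∈ Tri) : Fword w p ∈ Tri := by
  induction w with
  | nil => exact hp
  | cons i w ih => rw [Fword_cons]; exact F_mem i ih

lemma edge_succ (m : ℕ) (e : Sym2 (ℝ × ℝ)) :
    IsEdge (m + 1) e ↔ ∃ i : Fin 3, ∃ e', IsEdge m e' ∧ Sym2.map (Fmap i) e' = e := by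
  constructor
  · rintro ⟨x, y, ⟨hxy, w, hw, ⟨a, rfl⟩, ⟨b, rfl⟩⟩, rfl⟩
    cases w with
    | nil => simp at hw
    | cons i w =>
      refine ⟨i, s(Fword w (q a), Fword w (q b)), ⟨_, _, ⟨?_, w, by simpa using hw, ⟨a, rfl⟩, ⟨b, rfl⟩⟩, rfl⟩, rfl⟩
      intro h
      exact hxy (by rw [Fword_cons, Fword_cons, h])
  · rintro ⟨i, e', ⟨x, y, ⟨hxy, w, hw, ⟨a, rfl⟩, ⟨b, rfl⟩⟩, rfl⟩, rfl⟩
    exact ⟨_, _, ⟨fun h => hxy (F_inj i h), i :: w, by simp [hw], ⟨a, rfl⟩, ⟨b, rfl⟩⟩, rfl⟩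

lemma edge_zero (e : Sym2 (ℝ × ℝ)) :
    IsEdge 0 e ↔ e = s(q 0, q 1) ∨ e = s(q 0, q 2) ∨ e = s(q 1, q 2) := by
  constructor
  · rintro ⟨x, y, ⟨hxy, w, hw, ⟨a, rfl⟩, ⟨b, rfl⟩⟩, rfl⟩
    obtain rfl := List.length_eq_zero_iff.1 hw
    have hF : ∀ p, Fword [] p = p := fun p => rfl
    simp only [hF] at hxy ⊢
    fin_cases a <;> fin_cases b <;> simp at hxy ⊢
  · have hne : ∀ i j : Fin 3, i ≠ j → IsEdge 0 s(q i, q j) := fun i j hij =>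
      ⟨q i, q j, ⟨fun h => hij (q_inj h), [], rfl, ⟨i, rfl⟩, ⟨j, rfl⟩⟩, rfl⟩
    rintro (rfl | rfl | rfl) <;> apply hne <;> decide

open Classical in
def edges : ℕ → Finset (Sym2 (ℝ × ℝ))
  | 0 => {s(q 0, q 1), s(q 0, q 2), s(q 1, q 2)}
  | m + 1 => Finset.univ.biUnion fun i : Fin 3 => (edges m).image (Sym2.map (Fmap i))

lemma mem_edges (m : ℕ) (e : Sym2 (ℝ × ℝ)) : e ∈ edges m ↔ IsEdge m e := by
  induction m generalizing e with
  | zero => rw [edge_zero]; simp [edges]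
  | succ m ih =>
    rw [edge_succ]
    simp [edges, ih]

lemma energy_eq (m : ℕ) (u : ℝ × ℝ → ℝ) :
    Energy m u = (5 / 3) ^ m * ∑ e ∈ edges m, edgeVal u e := by
  unfold Energy
  congr 1
  have : {e | IsEdge m e} = (↑(edges m) : Set (Sym2 (ℝ × ℝ))) := by
    ext e; simp [mem_edges]
  change ∑' e : ↑{e | IsEdge m e}, edgeVal u e = _
  rw [this]
  exact Finset.tsum_subtype' _ _

lemma edgeVal_map (u : ℝ × ℝ → ℝ) (f : ℝ × ℝ → ℝ × ℝ) (e : Sym2 (ℝ × ℝ)) :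
    edgeVal u (Sym2.map f e) = edgeVal (u ∘ f) e := by
  induction e with | _ x y => rfl

lemma energy_succ (m : ℕ) (u : ℝ × ℝ → ℝ) :
    Energy (m + 1) u = 5 / 3 * (Energy m (u ∘ Fmap 0) + Energy m (u ∘ Fmap 1)
      + Energy m (u ∘ Fmap 2)) := by
  classical
  have key : ∑ e ∈ edges (m + 1), edgeVal u e =
      ∑ i : Fin 3, ∑ e ∈ edges m, edgeVal (u ∘ Fmap i) e := by
    rw [edges, Finset.sum_biUnion]
    · refine Finset.sum_congr rfl fun i _ => ?_
      rw [Finset.sum_image (fun a _ b _ h => Sym2.map.injective (F_inj i) h)]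
      simp [edgeVal_map]
    · intro i _ j _ hij
      refine Finset.disjoint_left.2 ?_
      intro e he he'
      simp only [Finset.mem_image, mem_edges] at he he'
      obtain ⟨e1, ⟨x, y, ⟨hxy, w, hw, ⟨a, rfl⟩, ⟨b, rfl⟩⟩, rfl⟩, rfl⟩ := he
      obtain ⟨e2, ⟨x', y', ⟨hxy', w', hw', ⟨a', rfl⟩, ⟨b', rfl⟩⟩, rfl⟩, h⟩ := he'
      simp only [Sym2.map_mk, Sym2.eq_iff] at h
      have hm := fun w a => Fword_mem w (q_mem a)
      rcases h with ⟨h1, h2⟩ | ⟨h1, h2⟩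
      · exact hxy ((cell_inter hij (hm _ _) (hm _ _) h1.symm).1.trans
          (cell_inter hij (hm _ _) (hm _ _) h2.symm).1.symm)
      · exact hxy ((cell_inter hij (hm _ _) (hm _ _) h2.symm).1.trans
          (cell_inter hij (hm _ _) (hm _ _) h1.symm).1.symm)
  simp only [energy_eq, key, Fin.sum_univ_three]
  ring

lemma energy_zero (u : ℝ × ℝ → ℝ) :
    Energy 0 u = (u (q 0) - u (q 1)) ^ 2 + (u (q 0) - u (q 2)) ^ 2 + (u (q 1) - u (q 2)) ^ 2 := by
  have h01 : q 0 ≠ q 1 := fun h => absurd (q_inj h) (by decide)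
  have h02 : q 0 ≠ q 2 := fun h => absurd (q_inj h) (by decide)
  have h12 : q 1 ≠ q 2 := fun h => absurd (q_inj h) (by decide)
  rw [energy_eq, edges, Finset.sum_insert, Finset.sum_insert, Finset.sum_singleton]
  · simp [edgeVal]; ring
  · simp [h01, h02]
  · simp [h01, h02, h12]

lemma energy_congr (m : ℕ) {u v : ℝ × ℝ → ℝ} (h : ∀ p ∈ Tri, u p = v p) :
    Energy m u = Energy m v := by
  induction m generalizing u v with
  | zero => simp [energy_zero, h _ (q_mem _)]
  | succ m ih =>
    rw [energy_succ, energy_succ]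
    have := fun i => @ih (u ∘ Fmap i) (v ∘ Fmap i) (fun p hp => h _ (F_mem i hp))
    simp [this]

lemma F_q (i j : Fin 3) : Fmap i (q j) = Fmap j (q i) := by
  simp [Fmap, add_comm]

lemma glue (U : Fin 3 → ℝ × ℝ → ℝ) (h : ∀ i j, U i (q j) = U j (q i)) :
    ∃ u : ℝ × ℝ → ℝ, ∀ i, ∀ p ∈ Tri, u (Fmap i p) = U i p := by
  classical
  refine ⟨fun x => if hx : ∃ ip : Fin 3 × (ℝ × ℝ), ip.2 ∈ Tri ∧ Fmap ip.1 ip.2 = x then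
    U hx.choose.1 hx.choose.2 else 0, ?_⟩
  intro i p hp
  have hx : ∃ ip : Fin 3 × (ℝ × ℝ), ip.2 ∈ Tri ∧ Fmap ip.1 ip.2 = Fmap i p := ⟨(i, p), hp, rfl⟩
  simp only [dif_pos hx]
  obtain ⟨h1, h2⟩ := hx.choose_spec
  generalize hx.choose = c at *
  by_cases hc : c.1 = i
  · rw [hc] at h2 ⊢
    rw [F_inj i h2]
  · obtain ⟨h3, h4⟩ := cell_inter hc h1 hp h2
    rw [h3, h4, h]

/-- Energy at level `n` versus at level `0`. -/
lemma energy_ge (n : ℕ) (u : ℝ × ℝ → ℝ) : Energy 0 u ≤ Energy n u := by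
  induction n generalizing u with
  | zero => exact le_rfl
  | succ n ih =>
    rw [energy_succ]
    have h0 := ih (u ∘ Fmap 0)
    have h1 := ih (u ∘ Fmap 1)
    have h2 := ih (u ∘ Fmap 2)
    simp only [energy_zero, Function.comp] at *
    rw [F_q 1 0, F_q 2 0] at *
    rw [F_q 2 1] at *
    have hq : ∀ i, Fmap i (q i) = q i := by
      intro i; apply bary_inj; intro k; rw [bary_F, bary_q]; split_ifs <;> norm_num
    simp only [hq] at *
    generalize u (q 0) = x at *
    generalize u (q 1) = y at *
    generalize u (q 2) = z at *
    generalize u (Fmap 0 (q 1)) = a at *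
    generalize u (Fmap 0 (q 2)) = b at *
    generalize u (Fmap 1 (q 2)) = c at *
    nlinarith [sq_nonneg (a + b + c - x - y - z), sq_nonneg (a - b - (y - z) / 5),
      sq_nonneg (a - c - (x - z) / 5), sq_nonneg (b - c - (x - y) / 5)]

lemma energy_attain (n : ℕ) (x : Fin 3 → ℝ) :
    ∃ u : ℝ × ℝ → ℝ, (∀ i, u (q i) = x i) ∧
      Energy n u = (x 0 - x 1) ^ 2 + (x 0 - x 2) ^ 2 + (x 1 - x 2) ^ 2 := by
  have hq : ∀ i, Fmap i (q i) = q i := by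
    intro i; apply bary_inj; intro k; rw [bary_F, bary_q]; split_ifs <;> norm_num
  induction n generalizing x with
  | zero =>
    classical
    have : ∃ u : ℝ × ℝ → ℝ, ∀ i, u (q i) = x i :=
      ⟨Function.extend q x 0, fun i => Function.Injective.extend_apply (fun _ _ h => q_inj h) _ _ _⟩
    obtain ⟨u, hu⟩ := this
    exact ⟨u, hu, by simp [energy_zero, hu]⟩
  | succ n ih =>
    -- the 1/5-2/5 rule
    let y : Fin 3 → Fin 3 → ℝ := fun i j => if i = j then x i else
      (x 0 + x 1 + x 2 + x i + x j) / 5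
    choose U hU hE using fun i => ih (y i)
    obtain ⟨u, hu⟩ := glue U (by
      intro i j
      rw [hU, hU]
      simp only [y]
      by_cases hij : i = j
      · subst hij; rfl
      · rw [if_neg hij, if_neg (Ne.symm hij)]; ring)
    refine ⟨u, ?_, ?_⟩
    · intro i
      rw [← hq i, hu _ _ (q_mem i), hU]
      simp [y]
    · rw [energy_succ]
      have := fun i => energy_congr n (u := u ∘ Fmap i) (v := U i) (hu i)
      rw [this, this, this, hE, hE, hE]
      simp [y]
      ring

def Dn : ℕ → ℝ
  | 0 => 2
  | n + 1 => 10 / 3 * Dn n / (Dn n + 1)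

def sig : ℕ → (ℕ → ℝ) → ℝ
  | 0, v => v 0 + v 1
  | n + 1, v => sig n v + sig n (fun k => v (2 ^ n + k))

def sn (n : ℕ) : ℝ := Dn n / 2 ^ (n + 1)

def Rn : ℕ → (ℕ → ℝ) → ℝ
  | 0, v => v 0 ^ 2 + v 1 ^ 2 + (v 0 - v 1) ^ 2
  | n + 1, v => 5 / 3 * (Rn n v + Rn n (fun k => v (2 ^ n + k)) -
      ((Dn n + 2) * ((sn n * sig n v) ^ 2 + (sn n * sig n (fun k => v (2 ^ n + k))) ^ 2)
        + 2 * (sn n * sig n v) * (sn n * sig n (fun k => v (2 ^ n + k))))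
        / ((Dn n + 1) * (Dn n + 3)))

def Bn (n : ℕ) (v : ℕ → ℝ) (t : ℝ) : ℝ := Rn n v - 2 * t * (sn n * sig n v) + Dn n * t ^ 2

lemma Dn_pos (n : ℕ) : 0 < Dn n := by
  induction n with
  | zero => norm_num [Dn]
  | succ n ih => rw [Dn]; positivity

lemma sn_succ (n : ℕ) : sn (n + 1) = 5 / 3 * sn n / (Dn n + 1) := by
  have := Dn_pos n
  simp only [sn, Dn]
  field_simp
  ring

/-- Completing the square. -/
lemma Bn_succ (n : ℕ) (v : ℕ → ℝ) (t a b : ℝ) :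
    5 / 3 * (Bn n v a + Bn n (fun k => v (2 ^ n + k)) b
        + ((t - a) ^ 2 + (t - b) ^ 2 + (a - b) ^ 2)) =
      Bn (n + 1) v t + 5 / 3 * (
        (Dn n + 2) * (a - ((Dn n + 2) * (t + sn n * sig n v)
          + (t + sn n * sig n (fun k => v (2 ^ n + k)))) / ((Dn n + 1) * (Dn n + 3))
          - (b - ((Dn n + 2) * (t + sn n * sig n (fun k => v (2 ^ n + k)))
          + (t + sn n * sig n v)) / ((Dn n + 1) * (Dn n + 3))) / (Dn n + 2)) ^ 2
        + ((Dn n + 1) * (Dn n + 3) / (Dn n + 2)) * (b -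
          ((Dn n + 2) * (t + sn n * sig n (fun k => v (2 ^ n + k)))
          + (t + sn n * sig n v)) / ((Dn n + 1) * (Dn n + 3))) ^ 2) := by
  have hD := Dn_pos n
  simp only [Bn, sn_succ, Rn, Dn, sig]
  generalize sig n (fun k => v (2 ^ n + k)) = β
  generalize sig n v = α
  generalize sn n = s
  generalize Rn n (fun k => v (2 ^ n + k)) = r'
  generalize Rn n v = r
  generalize Dn n = D at *
  field_simp
  ring

lemma xb_zero (n : ℕ) : xb n 0 = q 1 := by simp [xb]

lemma xb_top (n : ℕ) : xb n (2 ^ n) = q 2 := by simp [xb, q]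

lemma xb_left (n k : ℕ) : xb (n + 1) k = Fmap 1 (xb n k) := by
  simp [xb, Fmap, q]; ring

lemma xb_right (n k : ℕ) : xb (n + 1) (2 ^ n + k) = Fmap 2 (xb n k) := by
  simp [xb, Fmap, q]; field_simp; ring

lemma F_self (i : Fin 3) : Fmap i (q i) = q i := by
  apply bary_inj; intro k; rw [bary_F, bary_q]; split_ifs <;> norm_num

lemma xb_mem (n k : ℕ) (hk : k ≤ 2 ^ n) : xb n k ∈ Tri := by
  have h : (k : ℝ) / 2 ^ n ≤ 1 := by
    rw [div_le_one (by positivity)]; exact_mod_cast hk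
  have h0 : 0 ≤ (k : ℝ) / 2 ^ n := by positivity
  intro i
  fin_cases i <;> simp [bary, xb, q] <;> linarith

lemma energy_lower (n : ℕ) (u : ℝ × ℝ → ℝ) :
    Bn n (fun k => u (xb n k)) (u (q 0)) ≤ Energy n u := by
  induction n generalizing u with
  | zero =>
    have h0 := xb_zero 0
    have h1 := xb_top 0
    rw [pow_zero] at h1
    simp only [Bn, Rn, sn, sig, Dn, h0, h1, energy_zero]
    apply le_of_eq
    ring
  | succ n ih =>
    rw [energy_succ]
    have e0 := energy_ge n (u ∘ Fmap 0)
    rw [energy_zero] at e0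
    have e1 := ih (u ∘ Fmap 1)
    have e2 := ih (u ∘ Fmap 2)
    simp only [Function.comp, F_self, ← xb_left, ← xb_right] at e0 e1 e2
    rw [F_q 1 0] at e1
    rw [F_q 2 0] at e2
    have key := Bn_succ n (fun k => u (xb (n + 1) k)) (u (q 0)) (u (Fmap 0 (q 1)))
      (u (Fmap 0 (q 2)))
    have hD := Dn_pos n
    refine le_trans (b := _) ?_ (mul_le_mul_of_nonneg_left (add_le_add (add_le_add e0 e1) e2)
      (by norm_num))
    refine le_trans (le_add_of_nonneg_right ?_) (key.symm.le.trans (le_of_eq ?_))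
    · positivity
    · ring

lemma energy_upper (n : ℕ) (v : ℕ → ℝ) (t : ℝ) :
    ∃ u : ℝ × ℝ → ℝ, (∀ k ≤ 2 ^ n, u (xb n k) = v k) ∧ u (q 0) = t ∧ Energy n u = Bn n v t := by
  induction n generalizing v t with
  | zero =>
    obtain ⟨u, hu, hE⟩ := energy_attain 0 ![t, v 0, v 1]
    have h0 := xb_zero 0
    have h1 := xb_top 0
    rw [pow_zero] at h1
    refine ⟨u, ?_, by simp [hu], ?_⟩
    · intro k hk
      have : k = 0 ∨ k = 1 := by simp at hk; omega
      rcases this with rfl | rfl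
      · rw [h0, hu]; rfl
      · rw [h1, hu]; rfl
    · rw [hE]
      simp [Bn, Rn, sn, sig, Dn]
      ring
  | succ n ih =>
    obtain ⟨a, ha⟩ : ∃ a, a = ((Dn n + 2) * (t + sn n * sig n v)
          + (t + sn n * sig n (fun k => v (2 ^ n + k)))) / ((Dn n + 1) * (Dn n + 3)) := ⟨_, rfl⟩
    obtain ⟨b, hb⟩ : ∃ b, b = ((Dn n + 2) * (t + sn n * sig n (fun k => v (2 ^ n + k)))
          + (t + sn n * sig n v)) / ((Dn n + 1) * (Dn n + 3)) := ⟨_, rfl⟩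
    have key := Bn_succ n v t a b
    rw [← ha, ← hb] at key
    obtain ⟨u0, h0, E0⟩ := energy_attain n ![t, a, b]
    obtain ⟨u1, h1, h1', E1⟩ := ih v a
    obtain ⟨u2, h2, h2', E2⟩ := ih (fun k => v (2 ^ n + k)) b
    have g1 := h1 0 (by simp)
    have g2 := h1 (2 ^ n) le_rfl
    have g3 := h2 0 (by simp)
    have g4 := h2 (2 ^ n) le_rfl
    rw [xb_zero] at g1 g3
    rw [xb_top] at g2 g4
    obtain ⟨u, hu⟩ := glue ![u0, u1, u2] (by
      intro i j
      fin_cases i <;> fin_cases j <;> simp [h0, h1', h2', g1, g2, g3, g4])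
    have hu0 := hu 0
    have hu1 := hu 1
    have hu2 := hu 2
    simp only [Matrix.cons_val] at hu0 hu1 hu2
    refine ⟨u, ?_, ?_, ?_⟩
    · intro k hk
      rcases le_or_gt k (2 ^ n) with h | h
      · rw [xb_left, hu1 _ (xb_mem n k h), h1 k h]
      · obtain ⟨l, rfl⟩ := Nat.exists_eq_add_of_lt h
        have hl : l + 1 ≤ 2 ^ n := by rw [pow_succ] at hk; omega
        rw [add_assoc, xb_right, hu2 _ (xb_mem n _ hl), h2 _ hl]
    · rw [← F_self, hu0 _ (q_mem 0), h0]; rfl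
    · rw [energy_succ, energy_congr n (u := u ∘ Fmap 0) hu0, energy_congr n (u := u ∘ Fmap 1) hu1,
        energy_congr n (u := u ∘ Fmap 2) hu2, E0, E1, E2]
      simp only [Matrix.cons_val]
      simp only [sub_self, zero_div, mul_zero, add_zero, ne_eq, OfNat.ofNat_ne_zero,
        not_false_eq_true, zero_pow] at key
      rw [← key]
      ring

lemma Rn_congr_sig (n : ℕ) {v w : ℕ → ℝ} (h : ∀ k ≤ 2 ^ n, v k = w k) :
    Rn n v = Rn n w ∧ sig n v = sig n w := by
  induction n generalizing v w with
  | zero => simp [Rn, sig, h 0, h 1]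
  | succ n ih =>
    have h1 := @ih v w (fun k hk => h k (by rw [pow_succ]; omega))
    have h2 := @ih (fun k => v (2 ^ n + k)) (fun k => w (2 ^ n + k))
      (fun k hk => h _ (by rw [pow_succ]; omega))
    simp only [Rn, sig, h1.1, h1.2, h2.1, h2.2, and_self]

lemma Q_eq (n : ℕ) (v : ℝ × ℝ → ℝ) :
    Q n (Eplus n) v = Bn n (fun k => v (xb n k)) (v (q 0)) := by
  unfold Q
  apply IsLeast.csInf_eq
  constructor
  · obtain ⟨u, h1, h2, h3⟩ := energy_upper n (fun k => v (xb n k)) (v (q 0))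
    refine ⟨u, ?_, h3.symm⟩
    rintro x (rfl | ⟨k, hk, rfl⟩)
    · exact h2
    · exact h1 k hk
  · rintro r ⟨u, hu, rfl⟩
    refine le_trans (le_of_eq ?_) (energy_lower n u)
    obtain ⟨c1, c2⟩ := Rn_congr_sig n (v := fun k => v (xb n k)) (w := fun k => u (xb n k))
      (fun k hk => (hu _ (Or.inr ⟨k, hk, rfl⟩)).symm)
    simp only [Bn, c1, c2, hu (q 0) (Or.inl rfl)]

def dl (i : ℕ) : ℕ → ℝ := fun k => if k = i then 1 else 0

lemma ind_xb (n i k : ℕ) : ind (xb n i) (xb n k) = dl i k := by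
  have : xb n k = xb n i ↔ k = i := by
    simp [xb, q]
  simp only [ind, dl, this]

lemma ind_q0 (n i : ℕ) : ind (xb n i) (q 0) = 0 := by
  have : q 0 ≠ xb n i := by
    intro h
    have h2 := congrArg Prod.snd h
    simp [xb, q] at h2
  simp [ind, this]

lemma cond_eq (n i j : ℕ) : cond n (Eplus n) (xb n i) (xb n j) =
    (Rn n (dl i) + Rn n (dl j) - Rn n (dl i + dl j)) / 2 := by
  simp only [cond, Q_eq, Bn, Pi.add_apply, ind_q0, ind_xb]
  simp only [add_zero, mul_zero, zero_mul, sub_zero, ne_eq, OfNat.ofNat_ne_zero,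
    not_false_eq_true, zero_pow]
  rfl

lemma sig_add (n : ℕ) (v w : ℕ → ℝ) : sig n (v + w) = sig n v + sig n w := by
  induction n generalizing v w with
  | zero => simp [sig]; ring
  | succ n ih =>
    have := ih (fun k => v (2 ^ n + k)) (fun k => w (2 ^ n + k))
    simp only [sig, ih v w]
    have e : (fun k => (v + w) (2 ^ n + k)) =
      (fun k => v (2 ^ n + k)) + (fun k => w (2 ^ n + k)) := rfl
    rw [e, this]; ring

lemma zero_vals (n : ℕ) : sig n (fun _ => 0) = 0 ∧ Rn n (fun _ => 0) = 0 := by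
  induction n with
  | zero => simp [sig, Rn]
  | succ n ih => simp [sig, Rn, ih.1, ih.2]

lemma sig_dl (n i : ℕ) : sig n (dl i) =
    if i = 0 ∨ i = 2 ^ n then 1 else if i < 2 ^ n then 2 else 0 := by
  induction n generalizing i with
  | zero =>
    rcases i with _ | _ | i <;> simp [sig, dl]
  | succ n ih =>
    rw [sig, ih]
    have hp : 0 < 2 ^ n := by positivity
    rcases lt_or_ge i (2 ^ n) with h | h
    · have : (fun k => dl i (2 ^ n + k)) = fun _ => 0 := by
        funext k; simp only [dl]; rw [if_neg (by omega)]
      rw [this, (zero_vals n).1, pow_succ]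
      split_ifs <;> first | omega | norm_num
    · obtain ⟨l, rfl⟩ := Nat.exists_eq_add_of_le h
      have : (fun k => dl (2 ^ n + l) (2 ^ n + k)) = dl l := by
        funext k; simp [dl]
      rw [this, ih, pow_succ]
      split_ifs <;> first | omega | norm_num

lemma Dn_eq (n : ℕ) : Dn n = 14 * 10 ^ n / (3 ^ n + 6 * 10 ^ n) := by
  induction n with
  | zero => norm_num [Dn]
  | succ n ih =>
    rw [Dn, ih, pow_succ, pow_succ]
    have h3 : (0 : ℝ) < 3 ^ n := by positivity
    have h10 : (0 : ℝ) < 10 ^ n := by positivity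
    generalize (3 : ℝ) ^ n = x at *
    generalize (10 : ℝ) ^ n = y at *
    field_simp
    ring

lemma Rn_left (n : ℕ) (v : ℕ → ℝ) (h : (fun k => v (2 ^ n + k)) = fun _ => 0) :
    Rn (n + 1) v = 5 / 3 * (Rn n v - (Dn n + 2) * (sn n * sig n v) ^ 2
      / ((Dn n + 1) * (Dn n + 3))) := by
  rw [Rn, h, (zero_vals n).1, (zero_vals n).2]
  ring

end Helpers

/-- For `n ≥ 1` and `0 < i < j < 2ⁿ`, the recurrence relating the
conductances of `E_{n+1}⁺` (level `n+1`) and `E_n⁺` (level `n`) between interior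
bottom-row points. -/
theorem stmt14 (n : ℕ) (hn : 1 ≤ n) (i j : ℕ) (hi : 0 < i) (hij : i < j) (hj : j < 2 ^ n) :
    cond (n + 1) (Eplus (n + 1)) (xb (n + 1) i) (xb (n + 1) j) =
      5 / 3 * cond n (Eplus n) (xb n i) (xb n j) +
        196 * 25 ^ (n + 1) * (10 * 3 ^ (n + 1) + 39 * 10 ^ (n + 1)) /
          ((3 ^ (n + 1) + 6 * 10 ^ (n + 1)) * (5 * 3 ^ (n + 1) + 16 * 10 ^ (n + 1)) *
            (5 * 3 ^ (n + 1) + 9 * 10 ^ (n + 1))) := by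
  have hi' : i < 2 ^ n := hij.trans hj
  have z : ∀ i, i < 2 ^ n → ∀ k, dl i (2 ^ n + k) = 0 := by
    intro i h k; simp only [dl]; rw [if_neg (by omega)]
  have si : sig n (dl i) = 2 := by
    rw [sig_dl, if_neg (by omega), if_pos hi']
  have sj : sig n (dl j) = 2 := by
    rw [sig_dl, if_neg (by omega), if_pos hj]
  rw [cond_eq, cond_eq, Rn_left n (dl i) (funext (z i hi')), Rn_left n (dl j) (funext (z j hj)),
    Rn_left n (dl i + dl j) (funext fun k => by simp [z i hi', z j hj]), sig_add, si, sj]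
  have e25 : (25 : ℝ) ^ (n + 1) * (4 * 4 ^ n) = 100 * (10 ^ n) ^ 2 := by
    rw [← pow_mul, mul_comm n 2, pow_mul, pow_succ]
    have : (10 : ℝ) ^ 2 = 25 * 4 := by norm_num
    rw [this, mul_pow]; ring
  have e4 : ((2 : ℝ) ^ (n + 1)) ^ 2 = 4 * 4 ^ n := by
    rw [← pow_mul, mul_comm, pow_mul, pow_succ]; norm_num; ring
  have e25' : (25 : ℝ) ^ (n + 1) = 100 * (10 ^ n) ^ 2 / ((2 : ℝ) ^ (n + 1)) ^ 2 := by
    rw [e4, ← e25]; field_simp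
  rw [e25', sn, Dn_eq, pow_succ 3, pow_succ 10]
  have h3 : (0 : ℝ) < 3 ^ n := by positivity
  have h10 : (0 : ℝ) < 10 ^ n := by positivity
  have h2 : (0 : ℝ) < 2 ^ (n + 1) := by positivity
  generalize (3 : ℝ) ^ n = x at *
  generalize (10 : ℝ) ^ n = y at *
  generalize (2 : ℝ) ^ (n + 1) = w at *
  have hA : 14 * y / (x + 6 * y) + 1 = (x + 20 * y) / (x + 6 * y) := by field_simp; ring
  have hB : 14 * y / (x + 6 * y) + 3 = (3 * x + 32 * y) / (x + 6 * y) := by field_simp; ring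
  have hC : 14 * y / (x + 6 * y) + 2 = (2 * x + 26 * y) / (x + 6 * y) := by field_simp; ring
  rw [hA, hB, hC]
  have hd1 : x * 3 + 6 * (y * 10) = 3 * (x + 20 * y) := by ring
  have hd2 : 5 * (x * 3) + 16 * (y * 10) = 5 * (3 * x + 32 * y) := by ring
  have hd3 : 5 * (x * 3) + 9 * (y * 10) = 15 * (x + 6 * y) := by ring
  rw [hd1, hd2, hd3]
  generalize Rn n (dl i) = r1
  generalize Rn n (dl j) = r2
  generalize Rn n (dl i + dl j) = r3
  field_simp
  ring

end SGPaper
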